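/- arXiv:2408.14657 — 5 statements merged into one kernel-verified Lean document; each statement's English description precedes it below -/
import Mathlib

section
/- Let K be a number field or the function field of a curve, let d ≥ 2, let c ∈ K, and let v be a nonarchimedean place of K. If α ∈ K is preperiodic for x^d + c, then: (1) if |c|_v ≤ 1, then |α|_v ≤ 1; and (2) if |c|_v > 1, then |α|_v = |c|_v^{1/d}. -/
noncomputable section

/-- orbit-finiteness definition of preperiodicity -/
def Preperiodic {K : Type*} (φ : K → K) (α : K) : Prop :=
  (Set.range fun n : ℕ => φ^[n] α).Finite

/-- Axiomatization of the function field of a curve over a base field `k`: a family of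
(normalized, `ℤ`-valued) places trivial on `k`, with residue degrees `N v`, satisfying
the product formula, such that elements with no poles are constant (i.e. algebraic
over `k`); together with the genus. -/
structure FFData.{v, w, u} (K : Type u) [Field K] where
  k : Type v
  [instField : Field k]
  [instAlgebra : Algebra k K]
  Place : Type w
  ord : Place → K → ℤ
  N : Place → ℕ
  genus : ℕ
  N_pos : ∀ v, 0 < N v
  ord_mul : ∀ v (x y : K), x ≠ 0 → y ≠ 0 → ord v (x * y) = ord v x + ord v y
  ord_add : ∀ v (x y : K), x ≠ 0 → y ≠ 0 → x + y ≠ 0 →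
    min (ord v x) (ord v y) ≤ ord v (x + y)
  ord_surjective : ∀ v, ∃ x : K, x ≠ 0 ∧ ord v x = 1
  ord_const : ∀ v (a : k), a ≠ 0 → ord v (algebraMap k K a) = 0
  const_of_no_poles : ∀ x : K, x ≠ 0 → (∀ v, 0 ≤ ord v x) → IsAlgebraic k x
  finite_support : ∀ x : K, x ≠ 0 → {v | ord v x ≠ 0}.Finite
  product_formula : ∀ x : K, x ≠ 0 → (∑ᶠ v, (N v : ℤ) * ord v x) = 0

universe uv uw

theorem Preperiodic.map {K : Type*} {φ : K → K} {α : K} (h : Preperiodic φ α) :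
    Preperiodic φ (φ α) := by
  refine Set.Finite.subset h ?_
  rintro _ ⟨n, rfl⟩
  exact ⟨n + 1, Function.iterate_succ_apply φ n α⟩

/-- If a function strictly increases along the map on an invariant set,
then no point of that set is preperiodic. -/
theorem Preperiodic.not_of_strict_increase {K : Type*} {φ : K → K} {p : K → Prop} {f : K → ℝ}
    (hp : ∀ x, p x → p (φ x)) (hf : ∀ x, p x → f x < f (φ x)) {α : K} (hα : p α) :
    ¬ Preperiodic φ α := by
  have hpn : ∀ n : ℕ, p (φ^[n] α) := fun n => by
    induction n with
    | zero => exact hα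
    | succ n ih => rw [Function.iterate_succ_apply']; exact hp _ ih
  have hmono : StrictMono fun n : ℕ => f (φ^[n] α) := strictMono_nat_of_lt_succ fun n => by
    rw [Function.iterate_succ_apply']
    exact hf _ (hpn n)
  have hinj : Function.Injective fun n : ℕ => φ^[n] α :=
    Function.Injective.of_comp (f := f) hmono.injective
  exact Set.infinite_range_of_injective hinj

/-- A preperiodic point of `x ^ d + c` does not lie in the basin of infinity. -/
theorem Preperiodic.pow_le_of_one_lt {K : Type*} [Field K] {d : ℕ} (hd : 2 ≤ d) {c : K}
    {v : AbsoluteValue K ℝ} (hv : ∀ x y : K, v (x + y) ≤ max (v x) (v y))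
    {α : K} (hα : Preperiodic (fun x : K => x ^ d + c) α) (h1 : 1 < v α) :
    v α ^ d ≤ v c := by
  by_contra! hc
  have key : ∀ x : K, v c < v x ^ d → v (x ^ d + c) = v x ^ d := fun x hx => by
    rw [add_comm, IsNonarchimedean.add_eq_right_of_lt (f := v) hv (by rwa [map_pow]), map_pow]
  have grow : ∀ x : K, 1 < v x → v x < v x ^ d := fun x hx =>
    lt_self_pow₀ hx (by omega)
  refine Preperiodic.not_of_strict_increase (p := fun x => 1 < v x ∧ v c < v x ^ d) (f := v)
    ?_ ?_ ⟨h1, hc⟩ hα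
  · rintro x ⟨hx, hxc⟩
    have h := hx.trans (grow x hx)
    rw [← key x hxc] at h
    refine ⟨h, lt_trans ?_ (grow _ h)⟩
    rwa [key x hxc]
  · rintro x ⟨hx, hxc⟩
    rw [key x hxc]
    exact grow x hx

/-- **Nonarchimedean absolute values of preperiodic points** (Lemma 3.1).  Let `K` be
a number field or the function field of a curve, let `d ≥ 2`, `c ∈ K`, and let `v` be
a nonarchimedean place of `K` (a multiplicative absolute value satisfying the
ultrametric inequality).  If `α ∈ K` is preperiodic for `x ^ d + c`, then:
(1) if `|c|_v ≤ 1` then `|α|_v ≤ 1`; and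
(2) if `|c|_v > 1` then `|α|_v = |c|_v^{1/d}`. -/
theorem nonarch_absValue_of_preperiodic
    {K : Type*} [Field K]
    (hK : NumberField K ∨ Nonempty (FFData.{uv, uw} K))
    (d : ℕ) (hd : 2 ≤ d) (c : K)
    (v : AbsoluteValue K ℝ) (hv : ∀ x y : K, v (x + y) ≤ max (v x) (v y))
    (α : K) (hα : Preperiodic (fun x : K => x ^ d + c) α) :
    (v c ≤ 1 → v α ≤ 1) ∧ (1 < v c → v α = v c ^ ((d : ℝ)⁻¹)) := by
  have hd0 : d ≠ 0 := by omega
  refine ⟨fun hc => ?_, fun hc => ?_⟩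
  · by_contra! h
    exact absurd (hα.pow_le_of_one_lt hd hv h) (hc.trans_lt (one_lt_pow₀ h hd0)).not_ge
  · have hle : v α ^ d ≤ v c := by
      rcases le_or_gt (v α) 1 with h | h
      · exact (pow_le_one₀ (v.nonneg α) h).trans hc.le
      · exact hα.pow_le_of_one_lt hd hv h
    have heq : v α ^ d = v c := by
      refine hle.antisymm (not_lt.1 fun hlt => ?_)
      have hmap : v (α ^ d + c) = v c :=
        IsNonarchimedean.add_eq_right_of_lt (f := v) hv (by rwa [map_pow])
      have h := hα.map.pow_le_of_one_lt hd hv (hc.trans_eq hmap.symm)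
      rw [hmap] at h
      exact absurd h (lt_self_pow₀ hc (by omega)).not_ge
    rw [← heq, Real.pow_rpow_inv_natCast (v.nonneg α) hd0]

end
end

section
/- For each integer d ≥ 2 let F_d(x) = x^d − 2x − 1 ∈ ℝ[x]. Then F_d has a unique positive real root ρ_d, and the following hold: (1) ρ_d > 1 for all d ≥ 2; (2) the sequence (ρ_d)_{d ≥ 2} is strictly decreasing with limit 1; (3) the sequence (ρ_d^d)_{d ≥ 2} is strictly decreasing with limit 3. In particular, ρ_d ≤ ρ₂ = 1 + √2 and ρ_d^d ≤ ρ₂² = 3 + 2√2 for all d ≥ 2. -/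
open Filter

/-- A positive solution of `x ^ d = 2 * x + 1` with `d ≠ 0` exceeds `1`. -/
theorem one_lt_of_pow_eq_two_mul_add_one {d : ℕ} (hd : d ≠ 0) {x : ℝ} (hx : 0 < x)
    (h : x ^ d = 2 * x + 1) : 1 < x := by
  by_contra! hx1
  have := pow_le_of_le_one hx.le hx1 hd
  linarith

/-- Once `x ^ d` dominates `2 * x + 1`, it strictly dominates it at all larger points. -/
theorem two_mul_add_one_lt_pow_of_lt {d : ℕ} (hd : 2 ≤ d) {x y : ℝ} (hx : 0 < x)
    (hxy : x < y) (h : 2 * x + 1 ≤ x ^ d) : 2 * y + 1 < y ^ d := by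
  obtain ⟨k, rfl⟩ := Nat.exists_eq_add_of_le' hd
  have hy : 0 < y := hx.trans hxy
  have hlt : x ^ (k + 1) < y ^ (k + 1) := pow_lt_pow_left₀ hxy hx.le k.succ_ne_zero
  rw [pow_succ _ (k + 1)] at h ⊢
  have h2 : 2 < x ^ (k + 1) := by
    by_contra! hle
    nlinarith
  nlinarith [mul_pos (sub_pos.2 hxy) (sub_pos.2 h2), mul_pos hy (sub_pos.2 hlt)]

/-- For `d ≥ 2` the equation `x ^ d = 2 * x + 1` has exactly one positive solution. -/
theorem existsUnique_pos_pow_eq_two_mul_add_one {d : ℕ} (hd : 2 ≤ d) :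
    ∃! x : ℝ, 0 < x ∧ x ^ d = 2 * x + 1 := by
  have hcont : ContinuousOn (fun x : ℝ => x ^ d - 2 * x - 1) (Set.Icc 0 3) := by fun_prop
  have h9 : (3 : ℝ) ^ 2 ≤ 3 ^ d := pow_le_pow_right₀ (by norm_num) hd
  have hmem : (0 : ℝ) ∈ Set.Icc ((0 : ℝ) ^ d - 2 * 0 - 1) (3 ^ d - 2 * 3 - 1) := by
    rw [zero_pow (by omega)]
    constructor <;> linarith
  obtain ⟨x, hx, hx0⟩ := intermediate_value_Icc (by norm_num : (0 : ℝ) ≤ 3) hcont hmem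
  have hxd : x ^ d = 2 * x + 1 := by
    simp only at hx0
    linarith
  have hxpos : 0 < x := by
    refine lt_of_le_of_ne hx.1 fun h => ?_
    rw [← h, zero_pow (by omega)] at hxd
    norm_num at hxd
  refine ⟨x, ⟨hxpos, hxd⟩, ?_⟩
  rintro y ⟨hy, hyd⟩
  rcases lt_trichotomy y x with hlt | rfl | hlt
  · exact absurd hxd (two_mul_add_one_lt_pow_of_lt hd hy hlt hyd.ge).ne'
  · rfl
  · exact absurd hyd (two_mul_add_one_lt_pow_of_lt hd hxpos hlt hxd.ge).ne'

/-- **The auxiliary polynomials `F_d(x) = x^d − 2x − 1`** (Lemma 3.2).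
For each `d ≥ 2`, `F_d` has a unique positive real root `ρ_d`, and for any function
`ρ` selecting these roots:
(1) `ρ_d > 1` for all `d ≥ 2`;
(2) `(ρ_d)_{d ≥ 2}` is strictly decreasing with limit `1`;
(3) `(ρ_d ^ d)_{d ≥ 2}` is strictly decreasing with limit `3`.
In particular `ρ₂ = 1 + √2`, `ρ₂ ^ 2 = 3 + 2√2`, and `ρ_d ≤ 1 + √2`,
`ρ_d ^ d ≤ 3 + 2√2` for all `d ≥ 2`. -/
theorem unique_positive_root_of_F
    (F : ℕ → ℝ → ℝ) (hF : ∀ (d : ℕ) (x : ℝ), F d x = x ^ d - 2 * x - 1) :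
    (∀ d : ℕ, 2 ≤ d → ∃! x : ℝ, 0 < x ∧ F d x = 0) ∧
    (∀ ρ : ℕ → ℝ, (∀ d : ℕ, 2 ≤ d → 0 < ρ d ∧ F d (ρ d) = 0) →
      (∀ d : ℕ, 2 ≤ d → 1 < ρ d) ∧
      (∀ d : ℕ, 2 ≤ d → ρ (d + 1) < ρ d) ∧
      Tendsto ρ atTop (nhds 1) ∧
      (∀ d : ℕ, 2 ≤ d → ρ (d + 1) ^ (d + 1) < ρ d ^ d) ∧
      Tendsto (fun d : ℕ => ρ d ^ d) atTop (nhds 3) ∧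
      ρ 2 = 1 + Real.sqrt 2 ∧
      ρ 2 ^ 2 = 3 + 2 * Real.sqrt 2 ∧
      (∀ d : ℕ, 2 ≤ d → ρ d ≤ 1 + Real.sqrt 2) ∧
      (∀ d : ℕ, 2 ≤ d → ρ d ^ d ≤ 3 + 2 * Real.sqrt 2)) := by
  have key : ∀ (d : ℕ) (x : ℝ), F d x = 0 ↔ x ^ d = 2 * x + 1 := fun d x => by
    rw [hF, sub_sub, sub_eq_zero]
  simp only [key]
  refine ⟨fun d hd => existsUnique_pos_pow_eq_two_mul_add_one hd, fun ρ hρ => ?_⟩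
  have one_lt : ∀ d : ℕ, 2 ≤ d → 1 < ρ d := fun d hd =>
    one_lt_of_pow_eq_two_mul_add_one (by omega) (hρ d hd).1 (hρ d hd).2
  have anti : ∀ d : ℕ, 2 ≤ d → ρ (d + 1) < ρ d := by
    intro d hd
    obtain ⟨hpos, heq⟩ := hρ d hd
    have hd1 : 2 ≤ d + 1 := by omega
    have hlt : 2 * ρ d + 1 < ρ d ^ (d + 1) := by
      rw [pow_succ, heq]
      nlinarith [one_lt d hd]
    by_contra! hle
    rcases hle.eq_or_lt with h | h
    · exact hlt.ne' (h ▸ (hρ (d + 1) hd1).2)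
    · exact (two_mul_add_one_lt_pow_of_lt hd1 hpos h hlt.le).ne' (hρ (d + 1) hd1).2
  have hsq : Real.sqrt 2 ^ 2 = 2 := Real.sq_sqrt (by norm_num)
  have two : ρ 2 = 1 + Real.sqrt 2 :=
    (existsUnique_pos_pow_eq_two_mul_add_one le_rfl).unique (hρ 2 le_rfl)
      ⟨by positivity, by linear_combination hsq⟩
  have le_two : ∀ d : ℕ, 2 ≤ d → ρ d ≤ 1 + Real.sqrt 2 := by
    intro d hd
    induction d, hd using Nat.le_induction with
    | base => exact two.le
    | succ d hd ih => exact (anti d hd).le.trans ih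
  have pow_le : ∀ d : ℕ, 2 ≤ d → ρ d ^ d ≤ 3 + 2 * Real.sqrt 2 := fun d hd => by
    rw [(hρ d hd).2]
    linarith [le_two d hd]
  have tendsto_one : Tendsto ρ atTop (nhds 1) := by
    have hup : Tendsto (fun d : ℕ => 1 + (2 + 2 * Real.sqrt 2) / (d : ℝ)) atTop (nhds 1) := by
      simpa using (tendsto_const_div_atTop_nhds_zero_nat (2 + 2 * Real.sqrt 2)).const_add 1
    refine tendsto_of_tendsto_of_tendsto_of_le_of_le' tendsto_const_nhds hup ?_ ?_
    · filter_upwards [eventually_ge_atTop 2] with d hd using (one_lt d hd).le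
    · filter_upwards [eventually_ge_atTop 2] with d hd
      have hd0 : (0 : ℝ) < d := by exact_mod_cast (by omega : 0 < d)
      have hb := one_add_mul_sub_le_pow (by linarith [one_lt d hd] : -1 ≤ ρ d) d
      have : ρ d - 1 ≤ (2 + 2 * Real.sqrt 2) / d := by
        rw [le_div_iff₀ hd0]
        linarith [pow_le d hd]
      linarith
  refine ⟨one_lt, anti, tendsto_one, fun d hd => ?_, ?_, two, ?_, le_two, pow_le⟩
  · rw [(hρ d hd).2, (hρ (d + 1) (by omega)).2]
    linarith [anti d hd]
  · have hlim : Tendsto (fun d => 2 * ρ d + 1) atTop (nhds 3) := by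
      convert (tendsto_one.const_mul 2).add_const 1 using 2
      norm_num
    refine hlim.congr' ?_
    filter_upwards [eventually_ge_atTop 2] with d hd using (hρ d hd).2.symm
  · rw [two]
    linear_combination hsq
end

section
/- Let d ≥ 2, let K be a number field, let c ∈ K^×, and let φ(x) = x^d + c. Then: (1) φ has a 2-cycle {ω₁, ω₂} with ω₁, ω₂ ∈ μ_K (that is, φ(ω₁) = ω₂, φ(ω₂) = ω₁, and ω₁ ≠ ω₂) if and only if c = ω₁ + ω₂, ω₁^{d−1} = ω₂^{d−1} = −1, and ω₁ ≠ ω₂; and (2) φ has a 2-cycle {0, ω₃} with ω₃ ∈ μ_K if and only if c = ω₃ and ω₃^{d−1} = −1. -/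
/-- The set `μ_K` of roots of unity of `K`. -/
def rootsOfUnitySet (K : Type*) [Field K] : Set K :=
  {ζ : K | ∃ n : ℕ, 0 < n ∧ ζ ^ n = 1}

/-- Complex conjugation inverts roots of unity, so a linear relation between four roots of unity
also holds for their inverses. -/
theorem inv_add_inv_eq_of_add_eq {K : Type*} [Field K] [NumberField K] {a b u v : K}
    (ha : a ∈ rootsOfUnitySet K) (hb : b ∈ rootsOfUnitySet K)
    (hu : u ∈ rootsOfUnitySet K) (hv : v ∈ rootsOfUnitySet K) (h : a + b = u + v) :
    a⁻¹ + b⁻¹ = u⁻¹ + v⁻¹ := by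
  obtain ⟨σ⟩ : Nonempty (K →+* ℂ) := inferInstance
  have conj_eq {z : K} (hz : z ∈ rootsOfUnitySet K) :
      (starRingEnd ℂ) (σ z) = σ z⁻¹ := by
    obtain ⟨n, hn, hz⟩ := hz
    have hσ : σ z ^ n = 1 := by rw [← map_pow, hz, map_one]
    rw [map_inv₀, Complex.inv_eq_conj (Complex.norm_eq_one_of_pow_eq_one hσ hn.ne')]
  apply σ.injective
  rw [map_add, map_add, ← conj_eq ha, ← conj_eq hb, ← conj_eq hu, ← conj_eq hv,
    ← map_add, ← map_add, ← map_add, ← map_add, h]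

theorem ne_zero_of_mem_rootsOfUnitySet {K : Type*} [Field K] {z : K}
    (hz : z ∈ rootsOfUnitySet K) : z ≠ 0 := by
  rintro rfl
  obtain ⟨n, hn, h⟩ := hz
  simp [hn.ne'] at h

theorem pow_mem_rootsOfUnitySet {K : Type*} [Field K] {z : K}
    (hz : z ∈ rootsOfUnitySet K) (m : ℕ) : z ^ m ∈ rootsOfUnitySet K := by
  obtain ⟨n, hn, h⟩ := hz
  exact ⟨n, hn, by rw [pow_right_comm, h, one_pow]⟩

/-- Two equal sums of two roots of unity either vanish or have the same terms. -/
theorem add_eq_zero_or_eq_or_eq_of_add_eq {K : Type*} [Field K] [NumberField K] {a b u v : K}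
    (ha : a ∈ rootsOfUnitySet K) (hb : b ∈ rootsOfUnitySet K)
    (hu : u ∈ rootsOfUnitySet K) (hv : v ∈ rootsOfUnitySet K) (h : a + b = u + v) :
    a + b = 0 ∨ a = u ∨ a = v := by
  have hinv := inv_add_inv_eq_of_add_eq ha hb hu hv h
  have ha0 := ne_zero_of_mem_rootsOfUnitySet ha
  have hb0 := ne_zero_of_mem_rootsOfUnitySet hb
  have hu0 := ne_zero_of_mem_rootsOfUnitySet hu
  have hv0 := ne_zero_of_mem_rootsOfUnitySet hv
  rw [inv_add_inv ha0 hb0, inv_add_inv hu0 hv0,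
    div_eq_div_iff (mul_ne_zero ha0 hb0) (mul_ne_zero hu0 hv0)] at hinv
  have key : (a + b) * ((a - u) * (a - v)) = 0 := by
    linear_combination hinv + (a * (a + b) - a * b) * h
  simpa [sub_eq_zero] using key

theorem pow_pred_eq_neg_one_iff {K : Type*} [Field K] {d : ℕ} (hd : d ≠ 0) {z : K}
    (hz : z ≠ 0) : z ^ (d - 1) = -1 ↔ z ^ d + z = 0 := by
  rw [← pow_sub_one_mul hd z, ← add_one_mul, mul_eq_zero, or_iff_left hz, add_eq_zero_iff_eq_neg]

/-- **Classification of rational 2-cycles** (Lemma 4.8).  Let `d ≥ 2`, `K` a number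
field, `c ∈ K^×`, and `φ(x) = x ^ d + c`.  Then:
(1) `φ` has a 2-cycle `{ω₁, ω₂}` with `ω₁, ω₂ ∈ μ_K` iff `c = ω₁ + ω₂`,
`ω₁^{d−1} = ω₂^{d−1} = −1`, and `ω₁ ≠ ω₂`;
(2) `φ` has a 2-cycle `{0, ω₃}` with `ω₃ ∈ μ_K` iff `c = ω₃` and `ω₃^{d−1} = −1`. -/
theorem two_cycle_classification
    {K : Type*} [Field K] [NumberField K] (d : ℕ) (hd : 2 ≤ d) (c : K) (hc : c ≠ 0) :
    (∀ ω₁ ω₂ : K, ω₁ ∈ rootsOfUnitySet K → ω₂ ∈ rootsOfUnitySet K →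
      ((ω₁ ^ d + c = ω₂ ∧ ω₂ ^ d + c = ω₁ ∧ ω₁ ≠ ω₂) ↔
        (c = ω₁ + ω₂ ∧ ω₁ ^ (d - 1) = -1 ∧ ω₂ ^ (d - 1) = -1 ∧ ω₁ ≠ ω₂))) ∧
    (∀ ω₃ : K, ω₃ ∈ rootsOfUnitySet K →
      (((0 : K) ^ d + c = ω₃ ∧ ω₃ ^ d + c = 0) ↔
        (c = ω₃ ∧ ω₃ ^ (d - 1) = -1))) := by
  have hd0 : d ≠ 0 := by omega
  refine ⟨fun ω₁ ω₂ h₁ h₂ => ?_, fun ω₃ h₃ => ?_⟩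
  · rw [pow_pred_eq_neg_one_iff hd0 (ne_zero_of_mem_rootsOfUnitySet h₁),
      pow_pred_eq_neg_one_iff hd0 (ne_zero_of_mem_rootsOfUnitySet h₂)]
    constructor
    · rintro ⟨e₁, e₂, hne⟩
      have hsum : ω₁ + ω₁ ^ d = ω₂ + ω₂ ^ d := by linear_combination e₁ - e₂
      rcases add_eq_zero_or_eq_or_eq_of_add_eq h₁ (pow_mem_rootsOfUnitySet h₁ d) h₂
        (pow_mem_rootsOfUnitySet h₂ d) hsum with h | h | h
      · exact ⟨by linear_combination e₁ - h, by linear_combination h,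
          by linear_combination h - hsum, hne⟩
      · exact absurd h hne
      · exact absurd (by linear_combination e₂ + h) hc
    · rintro ⟨rfl, e₁, e₂, hne⟩
      exact ⟨by linear_combination e₁, by linear_combination e₂, hne⟩
  · rw [pow_pred_eq_neg_one_iff hd0 (ne_zero_of_mem_rootsOfUnitySet h₃), zero_pow hd0, zero_add]
    exact and_congr_right fun h => by rw [h]
end

section
/- Let d ≥ 2, let K be a number field, let c ∈ K^×, let φ(x) = x^d + c, and let ω₁, ω₂ ∈ μ_K. Then: (1) ω₁ is a fixed point of φ if and only if c = ω₁ − ω₁^d; and (2) assuming ω₁ is a fixed point of φ, an element ω₂ ∈ μ_K with ω₂ ≠ ω₁ is also a fixed point of φ if and only if ω₂ = −ω₁^d and ω₁ = −ω₂^d. -/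
open scoped ComplexConjugate in
/-- Two complex numbers of norm one with nonzero sum have their product determined by the sum. -/
theorem Complex.mul_eq_mul_of_add_eq_add_of_norm_eq_one {a b x y : ℂ}
    (ha : ‖a‖ = 1) (hb : ‖b‖ = 1) (hx : ‖x‖ = 1) (hy : ‖y‖ = 1)
    (h : a + b = x + y) (h0 : a + b ≠ 0) : a * b = x * y := by
  have conj_mul_self : ∀ {z : ℂ}, ‖z‖ = 1 → conj z * z = 1 := fun {z} hz => by
    simp [Complex.conj_mul', hz]
  have conj_add_mul : ∀ {z w : ℂ}, ‖z‖ = 1 → ‖w‖ = 1 → conj (z + w) * (z * w) = z + w :=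
    fun {z w} hz hw => by
      rw [map_add]
      linear_combination w * conj_mul_self hz + z * conj_mul_self hw
  refine mul_left_cancel₀ ((map_ne_zero (starRingEnd ℂ)).mpr h0) ?_
  rw [conj_add_mul ha hb, h, conj_add_mul hx hy]

/-- Two complex numbers of norm one are determined, up to order, by their sum if it is nonzero. -/
theorem Complex.eq_or_eq_of_add_eq_add_of_norm_eq_one {a b x y : ℂ}
    (ha : ‖a‖ = 1) (hb : ‖b‖ = 1) (hx : ‖x‖ = 1) (hy : ‖y‖ = 1)
    (h : a + b = x + y) (h0 : a + b ≠ 0) : x = a ∨ x = b := by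
  have hmul := Complex.mul_eq_mul_of_add_eq_add_of_norm_eq_one ha hb hx hy h h0
  have hroot : (x - a) * (x - b) = 0 := by linear_combination hmul - x * h
  exact (mul_eq_zero.mp hroot).imp sub_eq_zero.mp sub_eq_zero.mp

theorem norm_map_eq_one_of_mem_rootsOfUnitySet {K : Type*} [Field K] (f : K →+* ℂ) {ζ : K}
    (hζ : ζ ∈ rootsOfUnitySet K) : ‖f ζ‖ = 1 := by
  obtain ⟨n, hn, h⟩ := hζ
  exact Complex.norm_eq_one_of_pow_eq_one (by rw [← map_pow, h, map_one]) hn.ne'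

/-- **Root-of-unity fixed points** (Lemma 4.12 (1), (2)).  Let `d ≥ 2`, `K` a number
field, `c ∈ K^×`, `φ(x) = x ^ d + c`, and `ω₁, ω₂ ∈ μ_K`.  Then:
(1) `ω₁` is a fixed point of `φ` iff `c = ω₁ − ω₁^d`;
(2) if `ω₁` is a fixed point of `φ` and `ω₂ ≠ ω₁`, then `ω₂` is also a fixed point of
`φ` iff `ω₂ = −ω₁^d` and `ω₁ = −ω₂^d`. -/
theorem fixed_point_classification
    {K : Type*} [Field K] [NumberField K] (d : ℕ) (hd : 2 ≤ d) (c : K) (hc : c ≠ 0)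
    (ω₁ ω₂ : K) (hω₁ : ω₁ ∈ rootsOfUnitySet K) (hω₂ : ω₂ ∈ rootsOfUnitySet K) :
    ((ω₁ ^ d + c = ω₁) ↔ c = ω₁ - ω₁ ^ d) ∧
    (ω₁ ^ d + c = ω₁ → ω₂ ≠ ω₁ →
      ((ω₂ ^ d + c = ω₂) ↔ (ω₂ = -ω₁ ^ d ∧ ω₁ = -ω₂ ^ d))) := by
  refine ⟨eq_sub_iff_add_eq'.symm, fun h₁ hne => ⟨fun h₂ => ?_, fun ⟨h₂, h₃⟩ => ?_⟩⟩
  · obtain ⟨f⟩ : Nonempty (K →+* ℂ) := inferInstance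
    have n₁ := norm_map_eq_one_of_mem_rootsOfUnitySet f hω₁
    have n₂ := norm_map_eq_one_of_mem_rootsOfUnitySet f hω₂
    have hc₁ : ω₁ + -ω₁ ^ d = c := by linear_combination -h₁
    have hc₂ : ω₂ + -ω₂ ^ d = c := by linear_combination -h₂
    have hω : ω₂ = -ω₁ ^ d := by
      have key := Complex.eq_or_eq_of_add_eq_add_of_norm_eq_one
        (a := f ω₁) (b := f (-ω₁ ^ d)) (x := f ω₂) (y := f (-ω₂ ^ d))
        n₁ (by simp [n₁]) n₂ (by simp [n₂])
        (by rw [← map_add, ← map_add, hc₁, hc₂])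
        (by rw [← map_add, hc₁]; exact (map_ne_zero f).mpr hc)
      exact f.injective (key.resolve_left fun h => hne (f.injective h))
    exact ⟨hω, by linear_combination hc₁ - hc₂ + hω⟩
  · linear_combination h₁ - h₂ + h₃
end

section
/- Let K be a field of characteristic zero, let f(x) = x^d + c ∈ K[x] with d ≥ 2, and let g ∈ K[x] be monic and irreducible over K. If the composition g ∘ f is reducible in K[x], then g(f(0)) = (−1)^{e₁} · 4^{e₂} · y^m for some e₁, e₂ ∈ {0, 1}, some y ∈ K, and some divisor m of d with m ≥ 2. -/
open Polynomial

/-- If `h` is monic and irreducible and `h(0)` is not, up to sign, a `p`-th power,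
then `h(x ^ p)` is irreducible. -/
theorem Polynomial.irreducible_comp_X_pow_of_prime {K : Type*} [Field K] {h : K[X]}
    (hm : h.Monic) (hi : Irreducible h) {p : ℕ} (hp : p.Prime)
    (H : ∀ (e : ℕ) (y : K), h.eval 0 ≠ (-1) ^ e * y ^ p) :
    Irreducible (h.comp (X ^ p)) := by
  refine irreducible_comp hm (monic_X_pow p) hi fun E _ _ x hx ↦ ?_
  have hint : IsIntegral K x := by
    by_contra hx'
    exact hm.ne_zero (hx.symm.trans (minpoly.eq_zero hx'))
  rw [Polynomial.map_pow, map_X]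
  refine X_pow_sub_C_irreducible_of_prime hp fun b hb ↦ ?_
  apply H h.natDegree (Algebra.norm K b)
  rw [← map_pow, hb, ← IntermediateField.adjoin.powerBasis_gen hint,
    Algebra.PowerBasis.norm_gen_eq_coeff_zero_minpoly]
  simp [IntermediateField.minpoly_gen, hx, ← mul_assoc, ← mul_pow, coeff_zero_eq_eval_zero]

/-- If `h` is monic and irreducible and `h(0)` is not, up to sign, a `p`-th power for any
prime `p` dividing `d`, then `h(x ^ d)` is irreducible. -/
theorem Polynomial.irreducible_comp_X_pow {K : Type*} [Field K] {d : ℕ} (hd : d ≠ 0) {h : K[X]}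
    (hm : h.Monic) (hi : Irreducible h)
    (H : ∀ p : ℕ, p.Prime → p ∣ d → ∀ (e : ℕ) (y : K), h.eval 0 ≠ (-1) ^ e * y ^ p) :
    Irreducible (h.comp (X ^ d)) := by
  induction d using induction_on_primes generalizing h with
  | zero => exact absurd rfl hd
  | one => simpa using hi
  | prime_mul p n hp IH =>
    have hcomp : h.comp (X ^ (p * n)) = (h.comp (X ^ p)).comp (X ^ n) := by
      simp [comp_assoc, ← pow_mul, mul_comm p n]
    rw [hcomp]
    refine IH (right_ne_zero_of_mul hd) (hm.comp (monic_X_pow p) (by simpa using hp.ne_zero))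
      (irreducible_comp_X_pow_of_prime hm hi hp (H p hp (dvd_mul_right p n))) fun q hq hqn ↦ ?_
    simpa [eval_comp, hp.ne_zero] using H q hq (dvd_mul_of_dvd_right hqn p)

/-- **An irreducibility test for compositions with unicritical polynomials**
(Theorem 5.1).  Let `K` be a field of characteristic zero, let `f(x) = x ^ d + c` with
`d ≥ 2`, and let `g ∈ K[x]` be monic and irreducible over `K`.  If `g ∘ f` is
reducible in `K[x]`, then `g(f(0)) = (−1)^{e₁} · 4^{e₂} · y^m` for some
`e₁, e₂ ∈ {0, 1}`, some `y ∈ K`, and some divisor `m ≥ 2` of `d`. -/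
theorem comp_reducible_power
    {K : Type*} [Field K] [CharZero K] (d : ℕ) (hd : 2 ≤ d) (c : K)
    (g : Polynomial K) (hmonic : g.Monic) (hirr : Irreducible g)
    (hred : ¬ Irreducible (g.comp (X ^ d + C c))) :
    ∃ (e₁ e₂ : ℕ) (y : K) (m : ℕ), e₁ ≤ 1 ∧ e₂ ≤ 1 ∧ 2 ≤ m ∧ m ∣ d ∧
      g.eval ((X ^ d + C c).eval 0) = (-1) ^ e₁ * 4 ^ e₂ * y ^ m := by
  by_contra! hne
  have hcomp : g.comp (X ^ d + C c) = (g.comp (X + C c)).comp (X ^ d) := by simp [comp_assoc]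
  refine hred (hcomp ▸ irreducible_comp_X_pow (by lia) (hmonic.comp_X_add_C c) ?_ ?_)
  · have := (MulEquiv.irreducible_iff (algEquivAevalXAddC c)).mpr hirr
    simpa [comp_eq_aeval] using this
  · intro p hp hpd e y hy
    refine hne (e % 2) 0 y p (by lia) zero_le_one hp.two_le hpd ?_
    rw [← neg_one_pow_eq_pow_mod_two]
    simpa [eval_comp, show d ≠ 0 by lia] using hy
end
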